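/- For p ≥ 2, define F_p : ℝ^{2×2} → [0,∞) by F_p(A) = (max{a,0}·max{d,0} + ½(b² + c²))^{p/2} for A = [[a,b],[c,d]]. Then F_p is rank-one convex, non-negative and positively p-homogeneous. -/

import Mathlib

open Matrix MeasureTheory Set

/-- The operator norm `|A| = max_{|ξ|=1} |Aξ|` of a square matrix, computed via the
Euclidean spaces. -/
noncomputable def opNorm {n : ℕ} (A : Matrix (Fin n) (Fin n) ℝ) : ℝ :=
  ‖LinearMap.toContinuousLinearMap (Matrix.toEuclideanLin A)‖

/-- `F` is rank-one convex: `t ↦ F (A + t • X)` is convex whenever `rank X = 1`. -/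
def RankOneConvex {n : ℕ} (F : Matrix (Fin n) (Fin n) ℝ → ℝ) : Prop :=
  ∀ A X : Matrix (Fin n) (Fin n) ℝ, X.rank = 1 →
    ConvexOn ℝ Set.univ (fun t : ℝ => F (A + t • X))

/-- `F` is isotropic: `F (Q * A * R) = F A` for all `Q, R ∈ SO(n)`. -/
def Isotropic {n : ℕ} (F : Matrix (Fin n) (Fin n) ℝ → ℝ) : Prop :=
  ∀ (A Q R : Matrix (Fin n) (Fin n) ℝ),
    Qᵀ * Q = 1 → Q.det = 1 → Rᵀ * R = 1 → R.det = 1 → F (Q * A * R) = F A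

/-- `F` is positively `p`-homogeneous: `F (t • A) = t ^ p * F A` for `t > 0`. -/
def PosHomogeneous {n : ℕ} (p : ℝ) (F : Matrix (Fin n) (Fin n) ℝ → ℝ) : Prop :=
  ∀ (A : Matrix (Fin n) (Fin n) ℝ) (t : ℝ), 0 < t → F (t • A) = t ^ p * F A

/-- The set `CO(n) = {t • Q : Q ∈ O(n), t ∈ ℝ}` of conformal matrices. -/
def ConformalSet (n : ℕ) : Set (Matrix (Fin n) (Fin n) ℝ) :=
  {A | ∃ (t : ℝ) (Q : Matrix (Fin n) (Fin n) ℝ), Qᵀ * Q = 1 ∧ A = t • Q}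

/-- The matrix `Īd = diag(1, …, 1, -1)`. -/
noncomputable def Ibar (n : ℕ) : Matrix (Fin n) (Fin n) ℝ :=
  Matrix.diagonal (fun i => if (i : ℕ) = n - 1 then -1 else 1)

/-- The integrand `F_p(A) = (max(a,0)·max(d,0) + (b² + c²)/2)^(p/2)`. -/
noncomputable def Fp (p : ℝ) (A : Matrix (Fin 2) (Fin 2) ℝ) : ℝ :=
  (max (A 0 0) 0 * max (A 1 1) 0 + (A 0 1 ^ 2 + A 1 0 ^ 2) / 2) ^ (p / 2)

/-- The map `A ↦ max(a,0)·max(d,0) + (b² + c²)/2`, of which `F_p` is a power. -/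
noncomputable def FpBase (A : Matrix (Fin 2) (Fin 2) ℝ) : ℝ :=
  max (A 0 0) 0 * max (A 1 1) 0 + (A 0 1 ^ 2 + A 1 0 ^ 2) / 2

theorem FpBase_nonneg (A : Matrix (Fin 2) (Fin 2) ℝ) : 0 ≤ FpBase A := by
  unfold FpBase
  positivity

theorem FpBase_smul (A : Matrix (Fin 2) (Fin 2) ℝ) {t : ℝ} (ht : 0 ≤ t) :
    FpBase (t • A) = t ^ 2 * FpBase A := by
  have h (x : ℝ) : max (t * x) 0 = t * max x 0 := by
    rw [mul_max_of_nonneg _ _ ht, mul_zero]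
  simp only [FpBase, Matrix.smul_apply, smul_eq_mul, h]
  ring

/-- The product of positive parts is convex up to the error `r * s * |u - u'| * |v - v'|`. -/
theorem max_zero_mul_max_zero_combo_le (u v u' v' : ℝ) {r s : ℝ} (hr : 0 ≤ r) (hs : 0 ≤ s)
    (hrs : r + s = 1) :
    max (r * u + s * u') 0 * max (r * v + s * v') 0 ≤
      r * (max u 0 * max v 0) + s * (max u' 0 * max v' 0) +
        r * s * (|u - u'| * |v - v'|) := by
  have hmax (x y : ℝ) : max (r * x + s * y) 0 ≤ r * max x 0 + s * max y 0 :=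
    max_le (by gcongr <;> exact le_max_left _ _) (by positivity)
  have hlip : -((max u 0 - max u' 0) * (max v 0 - max v' 0)) ≤ |u - u'| * |v - v'| :=
    calc -((max u 0 - max u' 0) * (max v 0 - max v' 0))
        ≤ |max u 0 - max u' 0| * |max v 0 - max v' 0| := by
          rw [← abs_mul]; exact neg_le_abs _
      _ ≤ |u - u'| * |v - v'| := by
          exact mul_le_mul (abs_max_sub_max_le_abs _ _ _) (abs_max_sub_max_le_abs _ _ _)
            (abs_nonneg _) (abs_nonneg _)
  obtain rfl : s = 1 - r := by linarith
  calc max (r * u + (1 - r) * u') 0 * max (r * v + (1 - r) * v') 0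
      ≤ (r * max u 0 + (1 - r) * max u' 0) * (r * max v 0 + (1 - r) * max v' 0) :=
        mul_le_mul (hmax u u') (hmax v v') (le_max_right _ _) (by positivity)
    _ = r * (max u 0 * max v 0) + (1 - r) * (max u' 0 * max v' 0) +
          r * (1 - r) * -((max u 0 - max u' 0) * (max v 0 - max v' 0)) := by ring
    _ ≤ _ := by gcongr

theorem Matrix.det_eq_zero_of_rank_eq_one {X : Matrix (Fin 2) (Fin 2) ℝ} (hX : X.rank = 1) :
    X.det = 0 := by
  by_contra h
  have := Matrix.rank_of_isUnit X ((Matrix.isUnit_iff_isUnit_det X).2 (isUnit_iff_ne_zero.2 h))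
  simp [hX] at this

theorem rankOneConvex_FpBase : RankOneConvex FpBase := by
  intro A X hX
  have hdet := Matrix.det_eq_zero_of_rank_eq_one hX
  rw [Matrix.det_fin_two, sub_eq_zero] at hdet
  refine ⟨convex_univ, fun t _ t' _ r s hr hs hrs => ?_⟩
  have key := max_zero_mul_max_zero_combo_le (A 0 0 + t * X 0 0) (A 1 1 + t * X 1 1)
    (A 0 0 + t' * X 0 0) (A 1 1 + t' * X 1 1) hr hs hrs
  have hcombo (a x : ℝ) :
      r * (a + t * x) + s * (a + t' * x) = a + (r * t + s * t') * x := by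
    linear_combination a * hrs
  have habs : |A 0 0 + t * X 0 0 - (A 0 0 + t' * X 0 0)| *
      |A 1 1 + t * X 1 1 - (A 1 1 + t' * X 1 1)| ≤
        (t - t') ^ 2 * ((X 0 1 ^ 2 + X 1 0 ^ 2) / 2) := by
    rw [← abs_mul, show (A 0 0 + t * X 0 0 - (A 0 0 + t' * X 0 0)) *
      (A 1 1 + t * X 1 1 - (A 1 1 + t' * X 1 1)) = (t - t') ^ 2 * (X 0 1 * X 1 0) by
        linear_combination (t - t') ^ 2 * hdet, abs_mul, abs_of_nonneg (sq_nonneg (t - t'))]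
    gcongr
    exact abs_le.2 ⟨by nlinarith [sq_nonneg (X 0 1 + X 1 0)],
      by nlinarith [sq_nonneg (X 0 1 - X 1 0)]⟩
  have herr := mul_le_mul_of_nonneg_left habs (mul_nonneg hr hs)
  rw [hcombo, hcombo] at key
  simp only [FpBase, Matrix.add_apply, Matrix.smul_apply, smul_eq_mul]
  obtain rfl : s = 1 - r := by linarith
  linarith

/-- For `p ≥ 2`, the integrand `F_p` is rank-one convex, non-negative
and positively `p`-homogeneous. -/
theorem stmt_7 (p : ℝ) (hp : 2 ≤ p) :
    RankOneConvex (Fp p) ∧ (∀ A, 0 ≤ Fp p A) ∧ PosHomogeneous p (Fp p) := by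
  refine ⟨fun A X hX => ?_, fun A => Real.rpow_nonneg (FpBase_nonneg A) _, fun A t ht => ?_⟩
  · have hbase := rankOneConvex_FpBase A X hX
    have hp' : 1 ≤ p / 2 := by linarith
    refine ⟨convex_univ, fun t ht t' ht' r s hr hs hrs => ?_⟩
    exact (Real.rpow_le_rpow (FpBase_nonneg _) (hbase.2 ht ht' hr hs hrs) (by linarith)).trans
      ((convexOn_rpow hp').2 (FpBase_nonneg _) (FpBase_nonneg _) hr hs hrs)
  · change FpBase (t • A) ^ (p / 2) = t ^ p * FpBase A ^ (p / 2)
    rw [FpBase_smul A ht.le, Real.mul_rpow (sq_nonneg t) (FpBase_nonneg A),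
      ← Real.rpow_natCast_mul ht.le]
    congr 2
    push_cast
    ring
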